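/- Let D be an MHR value distribution with revenue curve R(q) = q·v(q) and monopoly quantile q* ∈ (0,1), and let R^exp be the revenue curve of the exponential distribution rescaled so that its value at quantile q* equals v(q*), i.e., R^exp(q) = v(q*)·q·(ln q)/(ln q*) for q ∈ (0,1]. Then for every q with q* ≤ q ≤ 1, R(q) ≥ R^exp(q). -/

import Mathlib

open MeasureTheory Set

/-- A value distribution on `[0,∞)` with CDF `F`, density `f` (w.r.t. Lebesgue measure),
whose support is an interval contained in `[0,∞)`. -/
structure ValueDist where
  μ : Measure ℝ
  isProb : IsProbabilityMeasure μ
  f : ℝ → ℝ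
  f_nonneg : ∀ x, 0 ≤ f x
  f_meas : Measurable f
  density_eq : μ = volume.withDensity fun x => ENNReal.ofReal (f x)
  supp : Set ℝ
  supp_subset : supp ⊆ Ici 0
  supp_conn : supp.OrdConnected
  f_pos : ∀ x ∈ supp, 0 < f x
  f_zero : ∀ x ∉ supp, f x = 0

/-- The CDF of a value distribution. -/
noncomputable def ValueDist.F (D : ValueDist) (x : ℝ) : ℝ := (D.μ (Iic x)).toReal

/-- The virtual value function `φ(v) = v - (1 - F v) / f v`. -/
noncomputable def ValueDist.phi (D : ValueDist) (x : ℝ) : ℝ := x - (1 - D.F x) / D.f x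

/-- Monotone hazard rate: the virtual value satisfies `dφ/dv ≥ 1` throughout the support. -/
def ValueDist.IsMHR (D : ValueDist) : Prop :=
  ∀ x ∈ D.supp, ∃ d : ℝ, 1 ≤ d ∧ HasDerivWithinAt D.phi d D.supp x

theorem ValueDist.integrable_f (D : ValueDist) : Integrable D.f := by
  refine ⟨D.f_meas.aestronglyMeasurable, ?_⟩
  rw [hasFiniteIntegral_iff_ofReal (Filter.Eventually.of_forall D.f_nonneg)]
  have h := D.isProb.measure_univ
  rw [D.density_eq, withDensity_apply _ MeasurableSet.univ, Measure.restrict_univ] at h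
  rw [h]; exact ENNReal.one_lt_top

theorem ValueDist.F_eq (D : ValueDist) (x : ℝ) : D.F x = ∫ t in Iic x, D.f t := by
  unfold ValueDist.F
  rw [integral_eq_lintegral_of_nonneg_ae (Filter.Eventually.of_forall D.f_nonneg)
    D.f_meas.aestronglyMeasurable]
  congr 1
  rw [D.density_eq, withDensity_apply _ measurableSet_Iic]

theorem ValueDist.F_eq' (D : ValueDist) (a : ℝ) :
    D.F = fun x => D.F a + ∫ t in a..x, D.f t := by
  funext x
  have := intervalIntegral.integral_Iic_sub_Iic (a := a) (b := x)
    D.integrable_f.integrableOn D.integrable_f.integrableOn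
  rw [← this, D.F_eq, D.F_eq]; ring

theorem ValueDist.F_cont (D : ValueDist) : Continuous D.F := by
  rw [D.F_eq' 0]
  exact continuous_const.add (intervalIntegral.continuous_primitive
    (fun a b => D.integrable_f.intervalIntegrable) 0)

theorem ValueDist.F_mono (D : ValueDist) : Monotone D.F := by
  intro a b hab
  have := congrFun (D.F_eq' a) b
  rw [this]
  have := intervalIntegral.integral_nonneg hab (fun u _ => D.f_nonneg u) (μ := volume)
  linarith

theorem ValueDist.convex_H (D : ValueDist) (hM : D.IsMHR) (a b : ℝ)
    (ha : a ∈ D.supp) (hb : b ∈ D.supp) (hF : D.F b < 1) :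
    ConvexOn ℝ (Icc a b) (fun x => - Real.log (1 - D.F x)) := by
  have hsub : Icc a b ⊆ D.supp := D.supp_conn.out ha hb
  have hpos : ∀ x ∈ Icc a b, 0 < 1 - D.F x := fun x hx => by
    have := D.F_mono hx.2
    linarith
  have hphi : ContinuousOn D.phi (Icc a b) := fun x hx => by
    obtain ⟨d, _, hd⟩ := hM x (hsub hx)
    exact hd.continuousWithinAt.mono hsub
  have hg : ∀ x, x - D.phi x = (1 - D.F x) / D.f x := fun x => by
    unfold ValueDist.phi; ring
  have hgpos : ∀ x ∈ Icc a b, 0 < x - D.phi x := fun x hx => by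
    rw [hg]; exact div_pos (hpos x hx) (D.f_pos x (hsub hx))
  have hfeq : ∀ x ∈ Icc a b, D.f x = (1 - D.F x) / (x - D.phi x) := fun x hx => by
    rw [hg]
    have := hpos x hx
    have := D.f_pos x (hsub hx)
    field_simp
  have hfc : ContinuousOn D.f (Icc a b) := by
    refine ContinuousOn.congr ?_ hfeq
    exact (continuous_const.sub D.F_cont).continuousOn.div (continuousOn_id.sub hphi)
      (fun x hx => (hgpos x hx).ne')
  have hFd : ∀ x ∈ Ioo a b, HasDerivAt D.F (D.f x) x := fun x hx => by
    rw [D.F_eq' a]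
    refine HasDerivAt.const_add _ ?_
    exact intervalIntegral.integral_hasDerivAt_right D.integrable_f.intervalIntegrable
      D.f_meas.stronglyMeasurable.stronglyMeasurableAtFilter
      (hfc.continuousAt (Icc_mem_nhds hx.1 hx.2))
  have hHd : ∀ x ∈ Ioo a b,
      HasDerivAt (fun x => - Real.log (1 - D.F x)) ((x - D.phi x)⁻¹) x := fun x hx => by
    have h := ((((hFd x hx).const_sub 1).log (hpos x (Ioo_subset_Icc_self hx)).ne')).neg
    have e : (x - D.phi x)⁻¹ = -(-D.f x / (1 - D.F x)) := by
      rw [hg, inv_div]; ring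
    rw [e]; exact h
  have hanti : AntitoneOn (fun x => x - D.phi x) (Icc a b) := by
    have hd : ∀ x ∈ Ioo a b, ∃ d : ℝ, d ≤ 0 ∧ HasDerivAt (fun x => x - D.phi x) d x := by
      intro x hx
      obtain ⟨d, hd1, hd⟩ := hM x (hsub (Ioo_subset_Icc_self hx))
      refine ⟨1 - d, by linarith, (hasDerivAt_id x).sub
        (hd.hasDerivAt (Filter.mem_of_superset (Icc_mem_nhds hx.1 hx.2) hsub))⟩
    refine antitoneOn_of_deriv_nonpos (convex_Icc a b) (continuousOn_id.sub hphi) ?_ ?_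
    · rw [interior_Icc]
      intro x hx
      obtain ⟨d, _, h⟩ := hd x hx
      exact h.differentiableAt.differentiableWithinAt
    · rw [interior_Icc]
      intro x hx
      obtain ⟨d, h0, h⟩ := hd x hx
      rw [h.deriv]; exact h0
  refine MonotoneOn.convexOn_of_deriv (convex_Icc a b) ?_ ?_ ?_
  · exact ((continuous_const.sub D.F_cont).continuousOn.log (fun x hx => (hpos x hx).ne')).neg
  · rw [interior_Icc]
    exact fun x hx => (hHd x hx).differentiableAt.differentiableWithinAt
  · rw [interior_Icc]
    intro x hx y hy hxy
    rw [(hHd x hx).deriv, (hHd y hy).deriv]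
    exact inv_anti₀ (hgpos y (Ioo_subset_Icc_self hy))
      (hanti (Ioo_subset_Icc_self hx) (Ioo_subset_Icc_self hy) hxy)

/-- For an MHR value distribution with value function `v` (the inverse of the quantile
function `q(x) = 1 - F x`), revenue curve `R(q) = q * v q` and monopoly quantile
`qs ∈ (0,1)`, the revenue curve dominates, on `[qs, 1]`, the revenue curve
`R^exp(q) = v(qs) · q · ln q / ln qs` of the exponential distribution rescaled so that
its value at quantile `qs` equals `v qs`. -/
theorem mhr_dominates_exponential_post_peak (D : ValueDist) (hMHR : D.IsMHR)
    (v : ℝ → ℝ)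
    (hv : ∀ q ∈ Ioc (0:ℝ) 1, v q ∈ D.supp ∧ 1 - D.F (v q) = q)
    (qs : ℝ) (hqs : qs ∈ Ioo (0:ℝ) 1)
    (hmax : ∀ q ∈ Ioc (0:ℝ) 1, q * v q ≤ qs * v qs) :
    ∀ q ∈ Icc qs 1, v qs * q * Real.log q / Real.log qs ≤ q * v q := by
  intro q hq
  obtain ⟨h0, h1⟩ := hqs
  have hq0 : 0 < q := h0.trans_le hq.1
  obtain ⟨sq, eq⟩ := hv q ⟨hq0, hq.2⟩
  obtain ⟨ss, es⟩ := hv qs ⟨h0, h1.le⟩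
  obtain ⟨s1, e1⟩ := hv 1 ⟨one_pos, le_rfl⟩
  have nq : 0 ≤ v q := D.supp_subset sq
  have n1 : 0 ≤ v 1 := D.supp_subset s1
  have hl : Real.log qs < 0 := Real.log_neg h0 h1
  rcases eq_or_lt_of_le hq.2 with rfl | hq1
  · simpa using n1
  rcases eq_or_lt_of_le hq.1 with rfl | hqq
  · rw [mul_div_assoc, div_self hl.ne]; linarith
  have l1 : v 1 < v q := D.F_mono.reflect_lt (by linarith)
  have l2 : v q < v qs := D.F_mono.reflect_lt (by linarith)
  have hc := D.convex_H hMHR (v 1) (v qs) s1 ss (by linarith)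
  have hpos : 0 < v qs - v 1 := by linarith
  have key := hc.2 (left_mem_Icc.2 (l1.trans l2).le) (right_mem_Icc.2 (l1.trans l2).le)
    (show 0 ≤ (v qs - v q) / (v qs - v 1) from div_nonneg (by linarith) hpos.le)
    (show 0 ≤ (v q - v 1) / (v qs - v 1) from div_nonneg (by linarith) hpos.le)
    (by field_simp; ring)
  have hx : ((v qs - v q) / (v qs - v 1)) • v 1 + ((v q - v 1) / (v qs - v 1)) • v qs = v q := by
    simp only [smul_eq_mul]; field_simp; ring
  rw [hx] at key
  simp only [eq, es, e1, smul_eq_mul, Real.log_one, neg_zero, mul_zero, zero_add] at key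
  rw [div_mul_eq_mul_div, le_div_iff₀ hpos] at key
  have hlq : Real.log qs < Real.log q := Real.log_lt_log h0 hqq
  have goal' : v q * Real.log qs ≤ v qs * Real.log q := by
    have hs : 0 < v qs := by linarith
    have hm : 0 ≤ v 1 * (v qs - v q) * (- Real.log qs) :=
      mul_nonneg (mul_nonneg n1 (by linarith)) (by linarith)
    have k2 := mul_le_mul_of_nonneg_left key hs.le
    have : (v qs - v 1) * (v q * Real.log qs) ≤ (v qs - v 1) * (v qs * Real.log q) := by
      nlinarith
    exact le_of_mul_le_mul_left this hpos
  rw [div_le_iff_of_neg hl]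
  nlinarith [mul_le_mul_of_nonneg_left goal' hq0.le]
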